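/- Counterfactual representation of the variance of the time-(K+1) component of the working-MSM efficient influence function with binary outcome: σ²_{K+1} := E_p[ C² · (y(l_{K+1}) − Q̄(ā(K), l̄(K)))² ] = Σ_{d1∈𝒟} h(d1,K+1) · Σ_{l̄(K)} P^{d1}_K(l̄(K)) · ( Σ_{d2∈𝒟} h(d2,K+1) · 1{d1(l̄(K)) = d2(l̄(K))} ) · Q̄(1 − Q̄)(d1(l̄(K)), l̄(K)) / g_{0:K}(d1(l̄(K)), l̄(K)). -/

import Mathlib

/-!
Longitudinal data with a binary final outcome: `O = (l̄(K), ā(K), Y)` with `Y : Bool`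
(`y(true) = 1`, `y(false) = 0`), full-support pmf `p`, treatment mechanism factors `g_t`,
covariate factors `q_t`, outcome regression `Q̄(ā(K), l̄(K)) = q_{K+1}(true ∣ l̄(K), ā(K))`,
a finite family `𝒟` of regimens with weights `h(·, K+1)`, and the time-`(K+1)` component
`D*_{K+1} = C · (y - Q̄)` of the working-MSM efficient influence function.
-/

open Finset
open scoped Classical

noncomputable section

variable {K : ℕ} {L : Fin (K + 1) → Type} {A : Fin (K + 1) → Type}

/-- Covariate histories `l̄(K)`. -/
abbrev Cov (K : ℕ) (L : Fin (K + 1) → Type) : Type := ∀ s : Fin (K + 1), L s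

/-- Treatment histories `ā(K)`. -/
abbrev Trt (K : ℕ) (A : Fin (K + 1) → Type) : Type := ∀ s : Fin (K + 1), A s

/-- Observations `(l̄(K), ā(K), Y)` with binary outcome `Y`. -/
abbrev Obs (K : ℕ) (L : Fin (K + 1) → Type) (A : Fin (K + 1) → Type) : Type :=
  Cov K L × Trt K A × Bool

/-- Agreement of covariate histories on indices `< t`. -/
def aL (t : ℕ) (l l' : Cov K L) : Prop := ∀ s : Fin (K + 1), (s : ℕ) < t → l s = l' s

/-- Agreement of treatment histories on indices `< t`. -/
def aA (t : ℕ) (a a' : Trt K A) : Prop := ∀ s : Fin (K + 1), (s : ℕ) < t → a s = a' s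

variable [∀ t, Fintype (L t)] [∀ t, Fintype (A t)]

/-- Mass of the event that covariates agree with `l` on indices `< tL` and treatments agree
with `a` on indices `< tA`. -/
def marg (p : Obs K L A → ℝ) (tL tA : ℕ) (l : Cov K L) (a : Trt K A) : ℝ :=
  ∑ o' : Obs K L A, if aL tL l o'.1 ∧ aA tA a o'.2.1 then p o' else 0

/-- Mass of the event that covariates and treatments agree with `(l, a)` everywhere and the
binary outcome equals `true`. -/
def margY (p : Obs K L A → ℝ) (l : Cov K L) (a : Trt K A) : ℝ :=
  ∑ o' : Obs K L A,
    if aL (K + 1) l o'.1 ∧ aA (K + 1) a o'.2.1 ∧ o'.2.2 = true then p o' else 0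

/-- The outcome regression `Q̄(ā(K), l̄(K)) = q_{K+1}(true ∣ l̄(K), ā(K))`. -/
def Qb (p : Obs K L A → ℝ) (l : Cov K L) (a : Trt K A) : ℝ :=
  margY p l a / marg p (K + 1) (K + 1) l a

/-- The conditional factor `q_t(l_t ∣ l̄(t-1), ā(t-1))` (for `t ≤ K`). -/
def qC (p : Obs K L A → ℝ) (t : ℕ) (l : Cov K L) (a : Trt K A) : ℝ :=
  marg p (t + 1) t l a / marg p t t l a

/-- The treatment mechanism factor `g_t(a_t ∣ l̄(t), ā(t-1))`. -/
def gC (p : Obs K L A → ℝ) (t : ℕ) (l : Cov K L) (a : Trt K A) : ℝ :=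
  marg p (t + 1) (t + 1) l a / marg p (t + 1) t l a

/-- The cumulative treatment probability `g_{0:t-1}`; `g_{0:K} = gCum p (K + 1)`. -/
def gCum (p : Obs K L A → ℝ) (t : ℕ) (l : Cov K L) (a : Trt K A) : ℝ :=
  ∏ m ∈ Finset.range t, gC p m l a

/-- The treatment history determined by the regimen `d` along the covariates `l`. -/
def aOf (d : ∀ t : Fin (K + 1), Cov K L → A t) (l : Cov K L) : Trt K A := fun s => d s l

/-- A regimen is adapted: `d_t` depends only on `l̄(t)`. -/
def Adapted (d : ∀ t : Fin (K + 1), Cov K L → A t) : Prop :=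
  ∀ t : Fin (K + 1), ∀ l l' : Cov K L, aL ((t : ℕ) + 1) l l' → d t l = d t l'

/-- The event `ā(K) = d(l̄(K))`. -/
def followsAll (d : ∀ t : Fin (K + 1), Cov K L → A t) (l : Cov K L) (a : Trt K A) : Prop :=
  ∀ s : Fin (K + 1), a s = d s l

/-- The real-valued binary outcome: `y(true) = 1`, `y(false) = 0`. -/
def yB (b : Bool) : ℝ := if b then 1 else 0

/-- The weight `C(ā(K), l̄(K)) = Σ_{d ∈ 𝒟} h(d,K+1) 1{ā(K) = d(l̄(K))} / g_{0:K}(ā(K), l̄(K))`. -/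
def Cw {D : Type} [Fintype D] (p : Obs K L A → ℝ)
    (ds : D → ∀ t : Fin (K + 1), Cov K L → A t) (h : D → ℝ)
    (l : Cov K L) (a : Trt K A) : ℝ :=
  ∑ i : D, h i * ((if followsAll (ds i) l a then (1 : ℝ) else 0) / gCum p (K + 1) l a)

/-- The G-computation mass `P^d_K(l̄(K)) = Π_{m=0}^{K} q_m(l_m ∣ l̄(m-1), d(l̄(m-1)))`. -/
def PdK (p : Obs K L A → ℝ) (d : ∀ t : Fin (K + 1), Cov K L → A t) (l : Cov K L) : ℝ :=
  ∏ m ∈ Finset.range (K + 1), qC p m l (aOf d l)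

theorem aL_top_iff {l l' : Cov K L} : aL (K + 1) l l' ↔ l' = l :=
  ⟨fun H => funext fun s => (H s s.isLt).symm, fun H _ _ => H ▸ rfl⟩

theorem aA_top_iff {a a' : Trt K A} : aA (K + 1) a a' ↔ a' = a :=
  ⟨fun H => funext fun s => (H s s.isLt).symm, fun H _ _ => H ▸ rfl⟩

theorem marg_pos (p : Obs K L A → ℝ) (hp : ∀ o, 0 < p o) (tL tA : ℕ)
    (l : Cov K L) (a : Trt K A) : 0 < marg p tL tA l a := by
  unfold marg
  refine Finset.sum_pos' (fun o _ => ?_) ⟨(l, a, true), Finset.mem_univ _, ?_⟩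
  · split_ifs
    exacts [(hp o).le, le_rfl]
  · rw [if_pos ⟨fun _ _ => rfl, fun _ _ => rfl⟩]
    exact hp _

theorem marg_zero_zero (p : Obs K L A → ℝ) (l : Cov K L) (a : Trt K A) :
    marg p 0 0 l a = ∑ o : Obs K L A, p o :=
  Finset.sum_congr rfl fun _ _ =>
    if_pos ⟨fun s hs => absurd hs s.val.not_lt_zero, fun s hs => absurd hs s.val.not_lt_zero⟩

theorem marg_top (p : Obs K L A → ℝ) (l : Cov K L) (a : Trt K A) :
    marg p (K + 1) (K + 1) l a = p (l, a, true) + p (l, a, false) := by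
  simp [marg, aL_top_iff, aA_top_iff, Fintype.sum_prod_type, ite_and, Finset.sum_ite_irrel,
    ← ite_add_zero]

theorem margY_eq (p : Obs K L A → ℝ) (l : Cov K L) (a : Trt K A) :
    margY p l a = p (l, a, true) := by
  simp [margY, aL_top_iff, aA_top_iff, Fintype.sum_prod_type, ite_and, Finset.sum_ite_irrel]

theorem gCum_pos (p : Obs K L A → ℝ) (hp : ∀ o, 0 < p o) (t : ℕ)
    (l : Cov K L) (a : Trt K A) : 0 < gCum p t l a :=
  Finset.prod_pos fun _ _ => div_pos (marg_pos p hp _ _ l a) (marg_pos p hp _ _ l a)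

/-- The marginal mass of a history factorizes into treatment and covariate factors. -/
theorem marg_eq_gCum_mul_prod_qC (p : Obs K L A → ℝ) (hp : ∀ o, 0 < p o)
    (hp1 : ∑ o : Obs K L A, p o = 1) (t : ℕ) (l : Cov K L) (a : Trt K A) :
    marg p t t l a = gCum p t l a * ∏ m ∈ Finset.range t, qC p m l a := by
  induction t with
  | zero => simp [gCum, marg_zero_zero, hp1]
  | succ t ih =>
    have hg : gCum p (t + 1) l a = gCum p t l a * gC p t l a := Finset.prod_range_succ _ _
    rw [hg, Finset.prod_range_succ, mul_mul_mul_comm, ← ih, gC, qC]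
    have h1 := (marg_pos p hp t t l a).ne'
    have h2 := (marg_pos p hp (t + 1) t l a).ne'
    field_simp

/-- The conditional variance of the binary outcome, times the mass of the history. -/
theorem sum_outcome_sq_dev (p : Obs K L A → ℝ) (hp : ∀ o, 0 < p o)
    (l : Cov K L) (a : Trt K A) :
    ∑ b : Bool, p (l, a, b) * (yB b - Qb p l a) ^ 2
      = marg p (K + 1) (K + 1) l a * (Qb p l a * (1 - Qb p l a)) := by
  have hM := (marg_pos p hp (K + 1) (K + 1) l a).ne'
  rw [Qb, margY_eq]
  rw [marg_top] at hM ⊢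
  simp only [Fintype.sum_bool, yB]
  field_simp
  simp
  ring

theorem followsAll_iff (d : ∀ t : Fin (K + 1), Cov K L → A t) (l : Cov K L) (a : Trt K A) :
    followsAll d l a ↔ a = aOf d l :=
  funext_iff.symm

theorem Cw_eq {D : Type} [Fintype D] (p : Obs K L A → ℝ)
    (ds : D → ∀ t : Fin (K + 1), Cov K L → A t) (h : D → ℝ) (l : Cov K L) (a : Trt K A) :
    Cw p ds h l a
      = (∑ i : D, h i * (if a = aOf (ds i) l then (1 : ℝ) else 0)) / gCum p (K + 1) l a := by
  simp only [Cw, followsAll_iff, Finset.sum_div, mul_div_assoc]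

/-- counterfactual (G-computation) representation of the variance of the
time-`(K+1)` component of the working-MSM efficient influence function with binary outcome. -/
theorem msm_last_component_counterfactual [∀ t, Nonempty (L t)] [∀ t, Nonempty (A t)]
    {D : Type} [Fintype D] [Nonempty D]
    (p : Obs K L A → ℝ) (hp : ∀ o, 0 < p o) (hp1 : ∑ o : Obs K L A, p o = 1)
    (ds : D → ∀ t : Fin (K + 1), Cov K L → A t) (hds : ∀ i, Adapted (ds i))
    (h : D → ℝ) :
    ∑ o : Obs K L A, p o * (Cw p ds h o.1 o.2.1 ^ 2 * (yB o.2.2 - Qb p o.1 o.2.1) ^ 2)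
      = ∑ i : D, h i *
          ∑ l : Cov K L, PdK p (ds i) l *
            ((∑ j : D, h j *
                (if (∀ s : Fin (K + 1), ds i s l = ds j s l) then (1 : ℝ) else 0)) *
              (Qb p l (aOf (ds i) l) * (1 - Qb p l (aOf (ds i) l))) /
              gCum p (K + 1) l (aOf (ds i) l)) := by
  have hw (l : Cov K L) (a : Trt K A) :
      ∑ b : Bool, p (l, a, b) * (Cw p ds h l a ^ 2 * (yB b - Qb p l a) ^ 2)
        = ∑ i : D, if a = aOf (ds i) l then
            h i * ((∏ m ∈ Finset.range (K + 1), qC p m l a) *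
              ((∑ j : D, h j * (if a = aOf (ds j) l then (1 : ℝ) else 0)) *
                (Qb p l a * (1 - Qb p l a)) / gCum p (K + 1) l a)) else 0 := by
    have hg := (gCum_pos p hp (K + 1) l a).ne'
    calc _ = Cw p ds h l a ^ 2 * ∑ b : Bool, p (l, a, b) * (yB b - Qb p l a) ^ 2 := by
          rw [Finset.mul_sum]
          exact Finset.sum_congr rfl fun _ _ => by ring
      _ = (∑ i : D, h i * (if a = aOf (ds i) l then (1 : ℝ) else 0)) *
            ((∏ m ∈ Finset.range (K + 1), qC p m l a) *
              ((∑ j : D, h j * (if a = aOf (ds j) l then (1 : ℝ) else 0)) *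
                (Qb p l a * (1 - Qb p l a)) / gCum p (K + 1) l a)) := by
          rw [sum_outcome_sq_dev p hp, marg_eq_gCum_mul_prod_qC p hp hp1, Cw_eq]
          field_simp
      _ = _ := by
          rw [Finset.sum_mul]
          refine Finset.sum_congr rfl fun i _ => ?_
          split_ifs <;> ring
  simp only [Fintype.sum_prod_type, hw]
  simp_rw [Finset.mul_sum (s := (Finset.univ : Finset (Cov K L)))]
  rw [Finset.sum_comm (s := (Finset.univ : Finset D))]
  refine Finset.sum_congr rfl fun l _ => ?_
  rw [Finset.sum_comm]
  refine Finset.sum_congr rfl fun i _ => ?_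
  rw [Finset.sum_ite_eq' Finset.univ (aOf (ds i) l), if_pos (Finset.mem_univ _)]
  simp only [PdK, funext_iff, aOf]

end
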